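/- For every λ > 0 and all nonnegative integers k₁, k₂, ℓ₁, ℓ₂, m₁, m₂, the quantity Γᴵᴵ = ∫_{ℝ²} (D^{m₁}_{x₁} D^{m₂}_{x₂} V₀₀²(x;λ)) (∂_{x₂} H_{k₁,k₂}(x;λ)) (D^{ℓ₁}_{x₁} D^{ℓ₂}_{x₂} φ₀₀(x;λ)) dx equals the finite combinatorial double sum ∑_{i=0}^{min(ℓ₁,k₁)} ∑_{j=0}^{min(ℓ₂,k₂−1)} C(ℓ₁,i) C(ℓ₂,j) (−1)^{ℓ₁+ℓ₂} (2^{i} k₁! / (λ^{2i} (k₁−i)!)) (2^{j+1} k₂! / (λ^{2(j+1)} (k₂−j−1)!)) · ℋ₂(m₁+k₁−i+ℓ₁−i, m₂+k₂−j−1+ℓ₂−j). -/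

import Mathlib

open MeasureTheory Real

/-- first partial derivative `∂_{x₁}` of a function on `ℝ²`. -/
noncomputable def pd1 (f : ℝ × ℝ → ℝ) : ℝ × ℝ → ℝ := fun x => deriv (fun s => f (s, x.2)) x.1

/-- second partial derivative `∂_{x₂}` of a function on `ℝ²`. -/
noncomputable def pd2 (f : ℝ × ℝ → ℝ) : ℝ × ℝ → ℝ := fun x => deriv (fun s => f (x.1, s)) x.2

/-- mixed partial derivative `∂^{k₁}_{x₁} ∂^{k₂}_{x₂}`. -/
noncomputable def md (k1 k2 : ℕ) (f : ℝ × ℝ → ℝ) : ℝ × ℝ → ℝ := pd1^[k1] (pd2^[k2] f)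

/-- the Gaussian vorticity `φ₀₀(x;λ) = (1/(πλ²)) exp(−|x|²/λ²)`. -/
noncomputable def phi00 (lam : ℝ) (x : ℝ × ℝ) : ℝ :=
  (1 / (π * lam ^ 2)) * Real.exp (-(x.1 ^ 2 + x.2 ^ 2) / lam ^ 2)

/-- first component of the Lamb–Oseen velocity field `V₀₀(x;λ)`. -/
noncomputable def V001 (lam : ℝ) (x : ℝ × ℝ) : ℝ :=
  (1 / (2 * π)) * (-x.2 / (x.1 ^ 2 + x.2 ^ 2)) * (1 - Real.exp (-(x.1 ^ 2 + x.2 ^ 2) / lam ^ 2))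

/-- second component of the Lamb–Oseen velocity field `V₀₀(x;λ)`. -/
noncomputable def V002 (lam : ℝ) (x : ℝ × ℝ) : ℝ :=
  (1 / (2 * π)) * (x.1 / (x.1 ^ 2 + x.2 ^ 2)) * (1 - Real.exp (-(x.1 ^ 2 + x.2 ^ 2) / lam ^ 2))

/-- two-dimensional Hermite polynomial `H_{n₁,n₂}(z;λ)` defined via the generating function. -/
noncomputable def hpoly (lam : ℝ) (n1 n2 : ℕ) (z : ℝ × ℝ) : ℝ :=
  md n1 n2 (fun τ => Real.exp ((2 * (τ.1 * z.1 + τ.2 * z.2) - (τ.1 ^ 2 + τ.2 ^ 2)) / lam ^ 2)) (0, 0)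

/-- Hermite function `φ_{k₁,k₂}(x;λ) = ∂^{k₁}_{x₁} ∂^{k₂}_{x₂} φ₀₀(x;λ)`. -/
noncomputable def hfun (lam : ℝ) (k1 k2 : ℕ) : ℝ × ℝ → ℝ := md k1 k2 (phi00 lam)

/-- explicit combinatorial expression `ℋ₂(α₁,α₂)` from the paper. -/
noncomputable def Htwo (lam : ℝ) (a1 a2 : ℕ) : ℝ :=
  if Odd a1 ∧ Even a2 then
    (1 / (2 * π)) * (1 / (2 * lam ^ 2)) ^ ((a1 + a2 + 1) / 2)
      * ((-1 : ℝ) ^ ((a1 + a2 - 1) / 2) / (Nat.factorial ((a1 + a2 + 1) / 2) : ℝ))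
      * (Nat.choose ((a1 + a2 - 1) / 2) ((a1 - 1) / 2) : ℝ)
      * (Nat.factorial a1 : ℝ) * (Nat.factorial a2 : ℝ)
  else 0

/-- The Hermite polynomials attached to the weight `exp (-t s²)`, given by their three-term
recurrence. -/
noncomputable def scaledHermite (t : ℝ) : ℕ → ℝ → ℝ
  | 0, _ => 1
  | 1, s => 2 * t * s
  | n + 2, s => 2 * t * s * scaledHermite t (n + 1) s - 2 * t * (n + 1) * scaledHermite t n s

lemma scaledHermite_zero (t s : ℝ) : scaledHermite t 0 s = 1 := by simp [scaledHermite]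

lemma scaledHermite_succ (t : ℝ) (n : ℕ) (s : ℝ) :
    scaledHermite t (n + 1) s
      = 2 * t * s * scaledHermite t n s - 2 * t * n * scaledHermite t (n - 1) s := by
  cases n with
  | zero => simp [scaledHermite]
  | succ n => simp [scaledHermite]

lemma hasDerivAt_scaledHermite (t : ℝ) (n : ℕ) (s : ℝ) :
    HasDerivAt (scaledHermite t n) (2 * t * n * scaledHermite t (n - 1) s) s := by
  induction n using Nat.twoStepInduction with
  | zero =>
    have h : scaledHermite t 0 = fun _ => 1 := funext (scaledHermite_zero t)
    simpa [h] using hasDerivAt_const s (1 : ℝ)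
  | one =>
    have h : scaledHermite t 1 = fun s => 2 * t * s := by
      funext s; simp [scaledHermite]
    rw [h]
    simpa [scaledHermite_zero] using (hasDerivAt_id s).const_mul (2 * t)
  | more n ih0 ih1 =>
    have h : scaledHermite t (n + 2) = fun s => 2 * t * s * scaledHermite t (n + 1) s
        - 2 * t * (n + 1) * scaledHermite t n s := by
      funext s; simp [scaledHermite]
    rw [h]
    have h1 := (((hasDerivAt_id s).const_mul (2 * t)).mul ih1).sub
      (ih0.const_mul (2 * t * (n + 1)))
    refine h1.congr_deriv ?_
    have h2 := scaledHermite_succ t n s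
    simp only [Nat.add_sub_cancel, id, Nat.cast_add, Nat.cast_one, Nat.cast_ofNat,
      show n + 2 - 1 = n + 1 from rfl]
    rw [h2]
    ring

/-- The `n`-th derivative in `s` of `exp (-t s²)`. -/
noncomputable def gaussDeriv (n : ℕ) (t s : ℝ) : ℝ :=
  (-1) ^ n * scaledHermite t n s * Real.exp (-t * s ^ 2)

lemma gaussDeriv_succ (n : ℕ) (t s : ℝ) :
    gaussDeriv (n + 1) t s
      = -(2 * t) * (s * gaussDeriv n t s) - 2 * t * n * gaussDeriv (n - 1) t s := by
  simp only [gaussDeriv, scaledHermite_succ]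
  cases n with
  | zero => simp; ring
  | succ n => simp only [Nat.add_sub_cancel, pow_succ]; ring

lemma hasDerivAt_exp_neg_mul_sq (t s : ℝ) :
    HasDerivAt (fun s => Real.exp (-t * s ^ 2)) (-(2 * t * s) * Real.exp (-t * s ^ 2)) s := by
  refine (((hasDerivAt_pow 2 s).const_mul (-t)).exp).congr_deriv ?_
  simp
  ring

lemma hasDerivAt_gaussDeriv (n : ℕ) (t s : ℝ) :
    HasDerivAt (gaussDeriv n t) (gaussDeriv (n + 1) t s) s := by
  refine (((hasDerivAt_scaledHermite t n s).const_mul ((-1) ^ n)).mul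
    (hasDerivAt_exp_neg_mul_sq t s)).congr_deriv ?_
  simp only [gaussDeriv, scaledHermite_succ, pow_succ]
  ring

/-- The `n`-th derivative in `s` of `s * exp (-t s²)`. -/
noncomputable def mulGaussDeriv (n : ℕ) (t s : ℝ) : ℝ :=
  s * gaussDeriv n t s + n * gaussDeriv (n - 1) t s

lemma hasDerivAt_mulGaussDeriv (n : ℕ) (t s : ℝ) :
    HasDerivAt (mulGaussDeriv n t) (mulGaussDeriv (n + 1) t s) s := by
  refine (((hasDerivAt_id s).mul (hasDerivAt_gaussDeriv n t s)).add
    ((hasDerivAt_gaussDeriv (n - 1) t s).const_mul (n : ℝ))).congr_deriv ?_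
  cases n with
  | zero => simp [mulGaussDeriv]; ring
  | succ n => simp [mulGaussDeriv]; ring

/-- Joint continuity together with polynomial growth in `s`, uniformly for `t ∈ [0, T]`. -/
def ModerateGrowth (T : ℝ) (F : ℝ → ℝ → ℝ) : Prop :=
  Continuous (Function.uncurry F) ∧
    ∃ (C : ℝ) (N : ℕ), 0 ≤ C ∧ ∀ t ∈ Set.Icc 0 T, ∀ s, |F t s| ≤ C * (1 + s ^ 2) ^ N

namespace ModerateGrowth

variable {T : ℝ} {F G : ℝ → ℝ → ℝ}

lemma mul (hF : ModerateGrowth T F) (hG : ModerateGrowth T G) :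
    ModerateGrowth T fun t s => F t s * G t s := by
  obtain ⟨cF, C, N, hC, h⟩ := hF
  obtain ⟨cG, D, M, hD, h'⟩ := hG
  refine ⟨by simp only [Function.uncurry_def] at *; fun_prop, C * D, N + M, by positivity,
    fun t ht s => ?_⟩
  rw [abs_mul, pow_add]
  calc |F t s| * |G t s| ≤ (C * (1 + s ^ 2) ^ N) * (D * (1 + s ^ 2) ^ M) :=
        mul_le_mul (h t ht s) (h' t ht s) (abs_nonneg _) (by positivity)
    _ = _ := by ring

lemma add (hF : ModerateGrowth T F) (hG : ModerateGrowth T G) :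
    ModerateGrowth T fun t s => F t s + G t s := by
  obtain ⟨cF, C, N, hC, h⟩ := hF
  obtain ⟨cG, D, M, hD, h'⟩ := hG
  refine ⟨by simp only [Function.uncurry_def] at *; fun_prop, C + D, N + M, by positivity,
    fun t ht s => ?_⟩
  have h1 : (1 : ℝ) ≤ 1 + s ^ 2 := by nlinarith [sq_nonneg s]
  calc |F t s + G t s| ≤ |F t s| + |G t s| := abs_add_le _ _
    _ ≤ C * (1 + s ^ 2) ^ N + D * (1 + s ^ 2) ^ M := add_le_add (h t ht s) (h' t ht s)
    _ ≤ C * (1 + s ^ 2) ^ (N + M) + D * (1 + s ^ 2) ^ (N + M) := by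
        gcongr <;> first | exact h1 | omega
    _ = _ := by ring

lemma of_continuous {f : ℝ → ℝ} (hf : Continuous f) : ModerateGrowth T fun t _ => f t := by
  obtain ⟨C, hC⟩ := (isCompact_Icc (a := (0 : ℝ)) (b := T)).exists_bound_of_continuousOn
    hf.continuousOn
  refine ⟨by simp only [Function.uncurry_def]; fun_prop, |C|, 0, abs_nonneg _, fun t ht s => ?_⟩
  simpa using (hC t ht).trans (le_abs_self C)

lemma id : ModerateGrowth T fun _ s => s := by
  refine ⟨by simp only [Function.uncurry_def]; fun_prop, 1, 1, zero_le_one, fun t _ s => ?_⟩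
  rw [pow_one, one_mul, abs_le]
  constructor <;> nlinarith [sq_nonneg (s - 1), sq_nonneg (s + 1)]

lemma exp : ModerateGrowth T fun t s => Real.exp (-t * s ^ 2) := by
  refine ⟨by simp only [Function.uncurry_def]; fun_prop, 1, 0, zero_le_one, fun t ht s => ?_⟩
  have : 0 ≤ t * s ^ 2 := mul_nonneg ht.1 (sq_nonneg s)
  simp [this]

lemma scaledHermite (n : ℕ) : ModerateGrowth T fun t s => scaledHermite t n s := by
  induction n using Nat.twoStepInduction with
  | zero =>
    simp only [_root_.scaledHermite]
    exact of_continuous continuous_const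
  | one =>
    simp only [_root_.scaledHermite]
    exact (of_continuous (f := fun t => 2 * t) (by fun_prop)).mul id
  | more n ih0 ih1 =>
    have h := (((of_continuous (T := T) (f := fun t => 2 * t) (by fun_prop)).mul id).mul ih1).add
      ((of_continuous (T := T) (f := fun t => -(2 * t * (n + 1))) (by fun_prop)).mul ih0)
    convert h using 3
    simp only [_root_.scaledHermite]
    ring

lemma gaussDeriv (n : ℕ) : ModerateGrowth T (gaussDeriv n) :=
  ((of_continuous continuous_const).mul (scaledHermite n)).mul exp

lemma mulGaussDeriv (n : ℕ) : ModerateGrowth T (mulGaussDeriv n) :=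
  (id.mul (gaussDeriv n)).add ((of_continuous continuous_const).mul (gaussDeriv (n - 1)))

lemma section_right {t : ℝ} (ht : t ∈ Set.Icc 0 T) (hF : ModerateGrowth T F) :
    ModerateGrowth T fun _ s => F t s := by
  obtain ⟨cF, C, N, hC, h⟩ := hF
  exact ⟨by simp only [Function.uncurry_def] at *; fun_prop, C, N, hC, fun _ _ s => h t ht s⟩

end ModerateGrowth

lemma integrable_polynomial_mul_gaussian {T : ℝ} (hT : 0 < T) (p : Polynomial ℝ) :
    Integrable fun s => p.eval s * Real.exp (-T * s ^ 2) := by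
  induction p using Polynomial.induction_on' with
  | add p q hp hq =>
    simp only [Polynomial.eval_add, add_mul]
    exact hp.add hq
  | monomial n a =>
    have h := (integrable_rpow_mul_exp_neg_mul_sq hT
      (s := n) (by have : (0 : ℝ) ≤ n := n.cast_nonneg
                   linarith)).const_mul a
    simpa [mul_assoc] using h

lemma integrable_one_add_sq_pow_mul_gaussian {T : ℝ} (hT : 0 < T) (C : ℝ) (N : ℕ) :
    Integrable fun s : ℝ => C * (1 + s ^ 2) ^ N * Real.exp (-T * s ^ 2) := by
  refine (integrable_polynomial_mul_gaussian hT
    (Polynomial.C C * (1 + Polynomial.X ^ 2) ^ N)).congr (Filter.Eventually.of_forall fun s => ?_)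
  simp [Polynomial.eval_pow]

lemma ModerateGrowth.integrable {T t : ℝ} {F : ℝ → ℝ → ℝ} (hF : ModerateGrowth T F) (hT : 0 < T)
    (ht : t ∈ Set.Icc 0 T) : Integrable fun s => F t s * Real.exp (-T * s ^ 2) := by
  obtain ⟨cF, C, N, hC, h⟩ := hF
  refine (integrable_one_add_sq_pow_mul_gaussian hT C N).mono'
    (Continuous.aestronglyMeasurable ?_) (Filter.Eventually.of_forall fun s => ?_)
  · simp only [Function.uncurry_def] at cF
    fun_prop
  · rw [norm_mul, Real.norm_eq_abs, Real.norm_eq_abs, Real.abs_exp]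
    gcongr
    exact h t ht s

/-- Integration by parts against a Hermite function. -/
lemma integral_deriv_mul_hermite {T : ℝ} (hT : 0 < T) {f f' : ℝ → ℝ}
    (hf : ModerateGrowth T fun _ => f) (hf' : ModerateGrowth T fun _ => f')
    (hd : ∀ s, HasDerivAt f (f' s) s) (l : ℕ) :
    ∫ s, f' s * scaledHermite T l s * Real.exp (-T * s ^ 2)
      = ∫ s, f s * scaledHermite T (l + 1) s * Real.exp (-T * s ^ 2) := by
  have hmem : T ∈ Set.Icc 0 T := ⟨hT.le, le_rfl⟩
  have hg : ∀ s, HasDerivAt (fun s => scaledHermite T l s * Real.exp (-T * s ^ 2))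
      (-(scaledHermite T (l + 1) s * Real.exp (-T * s ^ 2))) s := fun s => by
    refine ((hasDerivAt_scaledHermite T l s).mul (hasDerivAt_exp_neg_mul_sq T s)).congr_deriv ?_
    rw [scaledHermite_succ]
    ring
  have hH := fun n => (ModerateGrowth.scaledHermite (T := T) n).section_right hmem
  have key := integral_mul_deriv_eq_deriv_mul_of_integrable
    (u := f) (v := fun s => scaledHermite T l s * Real.exp (-T * s ^ 2)) (u' := f')
    (v' := fun s => -(scaledHermite T (l + 1) s * Real.exp (-T * s ^ 2)))
    (fun s _ => hd s) (fun s _ => hg s) ?_ ?_ ?_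
  · simp only [mul_neg, integral_neg, neg_inj, ← mul_assoc] at key
    exact key.symm
  · refine ((hf.mul (hH (l + 1))).integrable hT hmem).neg.congr
      (Filter.Eventually.of_forall fun s => ?_)
    simp [mul_assoc]
  · refine ((hf'.mul (hH l)).integrable hT hmem).congr (Filter.Eventually.of_forall fun s => ?_)
    simp [mul_assoc]
  · refine ((hf.mul (hH l)).integrable hT hmem).congr (Filter.Eventually.of_forall fun s => ?_)
    simp [mul_assoc]

section Sequence

variable {T : ℝ} {f : ℕ → ℝ → ℝ}

/-- Iterated integration by parts. -/
lemma integral_mul_hermite (hT : 0 < T) (hf : ∀ n, ModerateGrowth T fun _ => f n)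
    (hd : ∀ n s, HasDerivAt (f n) (f (n + 1) s) s) (n k : ℕ) :
    ∫ s, f n s * scaledHermite T k s * Real.exp (-T * s ^ 2)
      = ∫ s, f (n + k) s * Real.exp (-T * s ^ 2) := by
  induction k generalizing n with
  | zero => simp [scaledHermite_zero]
  | succ k ih =>
    rw [← integral_deriv_mul_hermite hT (hf n) (hf (n + 1)) (hd n) k, ih (n + 1)]
    congr! 3
    ring_nf

/-- Integral of a derivative against a product of two Hermite polynomials and the Gaussian
weight. -/
lemma integral_mul_hermite_mul_hermite (hT : 0 < T) (hf : ∀ n, ModerateGrowth T fun _ => f n)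
    (hd : ∀ n s, HasDerivAt (f n) (f (n + 1) s) s) (n k l : ℕ) :
    ∫ s, f n s * scaledHermite T k s * scaledHermite T l s * Real.exp (-T * s ^ 2)
      = ∑ i ∈ Finset.range (l + 1), (l.choose i : ℝ) * (2 * T) ^ i * (k.descFactorial i : ℝ)
          * ∫ s, f (n + (k - i) + (l - i)) s * Real.exp (-T * s ^ 2) := by
  have hmem : T ∈ Set.Icc 0 T := ⟨hT.le, le_rfl⟩
  have hH := fun n => (ModerateGrowth.scaledHermite (T := T) n).section_right hmem
  induction l generalizing n k with
  | zero => simpa [scaledHermite_zero] using integral_mul_hermite hT hf hd n k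
  | succ l ih =>
    have hc := ModerateGrowth.of_continuous (T := T) (f := fun _ => 2 * T * k) continuous_const
    have hI := ((hf (n + 1)).mul (hH k)).mul (hH l)
    have hI' := (hc.mul ((hf n).mul (hH (k - 1)))).mul (hH l)
    rw [← integral_deriv_mul_hermite hT ((hf n).mul (hH k))
      (((hf (n + 1)).mul (hH k)).add (hc.mul ((hf n).mul (hH (k - 1)))))
      (fun s => ((hd n s).mul (hasDerivAt_scaledHermite T k s)).congr_deriv (by ring)) l]
    simp only [add_mul]
    rw [integral_add (hI.integrable hT hmem) (hI'.integrable hT hmem), ih (n + 1) k]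
    have h2 : ∫ s, 2 * T * k * (f n s * scaledHermite T (k - 1) s) * scaledHermite T l s
          * Real.exp (-T * s ^ 2)
        = 2 * T * k * ∑ i ∈ Finset.range (l + 1), (l.choose i : ℝ) * (2 * T) ^ i
          * ((k - 1).descFactorial i : ℝ)
          * ∫ s, f (n + (k - 1 - i) + (l - i)) s * Real.exp (-T * s ^ 2) := by
      rw [← ih n (k - 1), ← integral_const_mul]
      congr! 2 with s
      ring
    rw [h2, Finset.sum_range_succ' _ (l + 1), Finset.mul_sum]
    have h3 : ∀ i, (k : ℝ) * ((k - 1).descFactorial i : ℝ) = (k.descFactorial (i + 1) : ℝ) := by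
      intro i
      cases k with
      | zero => simp
      | succ k =>
        rw [Nat.succ_descFactorial_succ]
        push_cast
        simp
    have h4 : ∀ i ∈ Finset.range (l + 1),
        ((l + 1).choose (i + 1) : ℝ) * (2 * T) ^ (i + 1) * (k.descFactorial (i + 1) : ℝ)
          * ∫ s, f (n + (k - (i + 1)) + (l + 1 - (i + 1))) s * Real.exp (-T * s ^ 2)
        = (l.choose (i + 1) : ℝ) * (2 * T) ^ (i + 1) * (k.descFactorial (i + 1) : ℝ)
          * (∫ s, f (n + (k - (i + 1)) + (l - i)) s * Real.exp (-T * s ^ 2))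
        + 2 * T * k * ((l.choose i : ℝ) * (2 * T) ^ i * ((k - 1).descFactorial i : ℝ)
          * ∫ s, f (n + (k - 1 - i) + (l - i)) s * Real.exp (-T * s ^ 2)) := by
      intro i _
      rw [Nat.choose_succ_succ, Nat.add_sub_add_right, ← h3, Nat.sub_sub k 1 i, Nat.add_comm 1 i]
      push_cast
      ring
    have h5 : ∀ i ∈ Finset.range l,
        (l.choose (i + 1) : ℝ) * (2 * T) ^ (i + 1) * (k.descFactorial (i + 1) : ℝ)
          * (∫ s, f (n + 1 + (k - (i + 1)) + (l - (i + 1))) s * Real.exp (-T * s ^ 2))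
        = (l.choose (i + 1) : ℝ) * (2 * T) ^ (i + 1) * (k.descFactorial (i + 1) : ℝ)
          * (∫ s, f (n + (k - (i + 1)) + (l - i)) s * Real.exp (-T * s ^ 2)) := by
      intro i hi
      have := Finset.mem_range.mp hi
      rw [show n + 1 + (k - (i + 1)) + (l - (i + 1)) = n + (k - (i + 1)) + (l - i) by omega]
    have h6 : ∑ i ∈ Finset.range (l + 1), (l.choose i : ℝ) * (2 * T) ^ i * (k.descFactorial i : ℝ)
          * (∫ s, f (n + 1 + (k - i) + (l - i)) s * Real.exp (-T * s ^ 2))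
        = ∑ i ∈ Finset.range (l + 1), (l.choose (i + 1) : ℝ) * (2 * T) ^ (i + 1)
          * (k.descFactorial (i + 1) : ℝ)
          * (∫ s, f (n + (k - (i + 1)) + (l - i)) s * Real.exp (-T * s ^ 2))
          + ∫ s, f (n + k + (l + 1)) s * Real.exp (-T * s ^ 2) := by
      rw [Finset.sum_range_succ', Finset.sum_range_succ _ l, Finset.sum_congr rfl h5,
        show n + 1 + (k - 0) + (l - 0) = n + k + (l + 1) by omega]
      simp
    rw [Finset.sum_congr rfl h4, Finset.sum_add_distrib, h6]
    simp
    ring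

end Sequence

/-- Only the indices `i ≤ min l k` contribute to the Hermite product expansion. -/
lemma sum_choose_mul_descFactorial_eq (l k : ℕ) (g : ℕ → ℝ) :
    ∑ i ∈ Finset.range (l + 1), (l.choose i : ℝ) * (k.descFactorial i : ℝ) * g i
      = ∑ i ∈ Finset.range (min l k + 1), (l.choose i : ℝ) * (k.descFactorial i : ℝ) * g i := by
  symm
  refine Finset.sum_subset (fun i hi => ?_) fun i hi hi' => ?_
  · simp only [Finset.mem_range] at *; omega
  · simp only [Finset.mem_range] at *
    rw [Nat.descFactorial_eq_zero_iff_lt.mpr (by omega : k < i)]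
    simp

/-- The `n`-th derivative of a Gaussian integrated against another Gaussian. -/
noncomputable def gaussPairing (T : ℝ) (n : ℕ) (t : ℝ) : ℝ :=
  ∫ s, gaussDeriv n t s * Real.exp (-T * s ^ 2)

/-- The `n`-th derivative of `s * exp (-t s²)` integrated against a Gaussian. -/
noncomputable def mulGaussPairing (T : ℝ) (n : ℕ) (t : ℝ) : ℝ :=
  ∫ s, mulGaussDeriv n t s * Real.exp (-T * s ^ 2)

section Pairing

variable {T t : ℝ}

lemma integral_mul_gaussDeriv (hT : 0 < T) (ht : t ∈ Set.Icc 0 T) (n : ℕ) :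
    ∫ s, s * gaussDeriv n t s * Real.exp (-T * s ^ 2) = gaussPairing T (n + 1) t / (2 * T) := by
  have h := integral_mul_hermite hT (f := fun n => gaussDeriv n t)
    (fun n => (ModerateGrowth.gaussDeriv n).section_right ht)
    (fun n s => hasDerivAt_gaussDeriv n t s) n 1
  rw [gaussPairing, ← h, eq_div_iff (by positivity), ← integral_mul_const]
  congr! 2 with s
  simp only [scaledHermite]
  ring

lemma gaussPairing_succ (hT : 0 < T) (ht : t ∈ Set.Icc 0 T) (n : ℕ) :
    gaussPairing T (n + 1) t = -2 * n * (t * T / (t + T)) * gaussPairing T (n - 1) t := by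
  have h : gaussPairing T (n + 1) t = -(2 * t) * (gaussPairing T (n + 1) t / (2 * T))
      - 2 * t * n * gaussPairing T (n - 1) t := by
    conv_lhs => rw [gaussPairing]
    rw [← integral_mul_gaussDeriv hT ht n, gaussPairing, ← integral_const_mul,
      ← integral_const_mul, ← integral_sub]
    · congr! 2 with s
      rw [gaussDeriv_succ]
      ring
    · exact ((ModerateGrowth.id.mul (ModerateGrowth.gaussDeriv n)).integrable hT ht).const_mul _
    · exact ((ModerateGrowth.gaussDeriv (n - 1)).integrable hT ht).const_mul _
  have h0 : t + T ≠ 0 := by linarith [ht.1]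
  field_simp at h ⊢
  linear_combination h

lemma mulGaussPairing_eq (hT : 0 < T) (ht : t ∈ Set.Icc 0 T) (n : ℕ) :
    mulGaussPairing T n t = n * (T / (t + T)) * gaussPairing T (n - 1) t := by
  have h : mulGaussPairing T n t
      = gaussPairing T (n + 1) t / (2 * T) + n * gaussPairing T (n - 1) t := by
    rw [mulGaussPairing, ← integral_mul_gaussDeriv hT ht n, gaussPairing, ← integral_const_mul,
      ← integral_add]
    · congr! 2 with s
      rw [mulGaussDeriv]
      ring
    · exact (ModerateGrowth.id.mul (ModerateGrowth.gaussDeriv n)).integrable hT ht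
    · exact ((ModerateGrowth.gaussDeriv (n - 1)).integrable hT ht).const_mul _
  have h0 : t + T ≠ 0 := by linarith [ht.1]
  rw [h, gaussPairing_succ hT ht]
  field_simp
  ring

lemma gaussPairing_odd (hT : 0 < T) (ht : t ∈ Set.Icc 0 T) (p : ℕ) :
    gaussPairing T (2 * p + 1) t = 0 := by
  induction p with
  | zero => simp [gaussPairing_succ hT ht]
  | succ p ih =>
    rw [gaussPairing_succ hT ht, show 2 * (p + 1) - 1 = 2 * p + 1 by omega, ih, mul_zero]

lemma gaussPairing_even (hT : 0 < T) (ht : t ∈ Set.Icc 0 T) (p : ℕ) :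
    gaussPairing T (2 * p) t
      = √(π / (t + T)) * ((-1) ^ p * (2 * p).factorial / p.factorial) * (t * T / (t + T)) ^ p := by
  induction p with
  | zero =>
    simp only [gaussPairing, mul_zero, gaussDeriv, scaledHermite_zero, pow_zero, one_mul,
      ← Real.exp_add]
    rw [← integral_gaussian]
    simp
    congr! 3 with s
    ring
  | succ p ih =>
    rw [show 2 * (p + 1) = 2 * p + 1 + 1 by ring, gaussPairing_succ hT ht, Nat.add_sub_cancel, ih,
      Nat.factorial_succ (2 * p + 1), Nat.factorial_succ (2 * p), Nat.factorial_succ p]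
    have : (p.factorial : ℝ) ≠ 0 := by positivity
    push_cast
    field_simp
    ring

end Pairing

/-- The product of the one-dimensional pairings for odd first index and even second index. -/
lemma mulGaussPairing_mul_gaussPairing {T t : ℝ} (hT : 0 < T) (ht : t ∈ Set.Icc 0 T) (p q : ℕ) :
    mulGaussPairing T (2 * p + 1) t * gaussPairing T (2 * q) t
      = π * ((-1) ^ (p + q) * (2 * p + 1).factorial * (2 * q).factorial
          / (p.factorial * q.factorial))
        * (T / (t + T) ^ 2 * (t * T / (t + T)) ^ (p + q)) := by
  have h0 : 0 < t + T := by linarith [ht.1]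
  rw [mulGaussPairing_eq hT ht, Nat.add_sub_cancel, gaussPairing_even hT ht,
    gaussPairing_even hT ht, Nat.factorial_succ (2 * p), pow_add, pow_add]
  have h1 : √(π / (t + T)) * √(π / (t + T)) = π / (t + T) :=
    Real.mul_self_sqrt (by positivity)
  set r := √(π / (t + T))
  set w := t * T / (t + T)
  have h2 : π * (T / (t + T) ^ 2) = T / (t + T) * (r * r) := by
    rw [h1]; field_simp
  push_cast
  linear_combination (-((2 * p + 1) * ((-1) ^ p * (-1) ^ q * (2 * p).factorial * (2 * q).factorial
    / (p.factorial * q.factorial)) * w ^ p * w ^ q)) * h2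

lemma mulGaussPairing_mul_gaussPairing_eq_zero {T t : ℝ} (hT : 0 < T) (ht : t ∈ Set.Icc 0 T)
    {a b : ℕ} (h : ¬(Odd a ∧ Even b)) : mulGaussPairing T a t * gaussPairing T b t = 0 := by
  rcases Nat.even_or_odd' b with ⟨q, rfl | rfl⟩
  · have ha : Even a := by
      by_contra ha
      exact h ⟨Nat.not_even_iff_odd.mp ha, even_two_mul q⟩
    obtain ⟨p, rfl⟩ := ha.two_dvd
    rw [mulGaussPairing_eq hT ht]
    cases p with
    | zero => simp
    | succ p =>
      rw [show 2 * (p + 1) - 1 = 2 * p + 1 by omega, gaussPairing_odd hT ht]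
      simp
  · rw [gaussPairing_odd hT ht, mul_zero]

lemma intervalIntegrable_and_integral_pairing {T : ℝ} (hT : 0 < T) (n : ℕ) :
    IntervalIntegrable (fun t => T / (t + T) ^ 2 * (t * T / (t + T)) ^ n) volume 0 T ∧
      ∫ t in (0)..T, T / (t + T) ^ 2 * (t * T / (t + T)) ^ n
        = (T / 2) ^ (n + 1) / ((n + 1) * T) := by
  have hpos : ∀ t ∈ Set.uIcc 0 T, t + T ≠ 0 := fun t ht => by
    rw [Set.uIcc_of_le hT.le] at ht
    linarith [ht.1]
  have hi : IntervalIntegrable (fun t => T / (t + T) ^ 2 * (t * T / (t + T)) ^ n) volume 0 T := by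
    apply ContinuousOn.intervalIntegrable
    have h : ∀ t ∈ Set.uIcc 0 T, (t + T) ^ 2 ≠ 0 := fun t ht => pow_ne_zero 2 (hpos t ht)
    fun_prop (disch := assumption)
  refine ⟨hi, ?_⟩
  rw [intervalIntegral.integral_eq_sub_of_hasDerivAt
    (f := fun t => (t * T / (t + T)) ^ (n + 1) / ((n + 1) * T)) _ hi]
  · simp only [zero_mul, zero_div, zero_pow n.succ_ne_zero, sub_zero]
    rw [show T * T / (T + T) = T / 2 by field_simp; ring]
  · intro t ht
    have h0 := hpos t ht
    have h1 : HasDerivAt (fun t => t * T / (t + T)) (T ^ 2 / (t + T) ^ 2) t := by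
      refine (((hasDerivAt_id t).mul_const T).div ((hasDerivAt_id t).add_const T) h0).congr_deriv ?_
      simp only [id]
      ring
    refine ((h1.pow (n + 1)).div_const ((n + 1) * T)).congr_deriv ?_
    have : (n : ℝ) + 1 ≠ 0 := by positivity
    push_cast
    field_simp

lemma intervalIntegrable_mulGaussPairing_mul_gaussPairing {T : ℝ} (hT : 0 < T) (a b : ℕ) :
    IntervalIntegrable (fun t => mulGaussPairing T a t * gaussPairing T b t) volume 0 T := by
  have hsub : ∀ t ∈ Set.uIoc 0 T, t ∈ Set.Icc 0 T := fun t ht => by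
    rw [Set.uIoc_of_le hT.le] at ht
    exact ⟨ht.1.le, ht.2⟩
  by_cases h : Odd a ∧ Even b
  · obtain ⟨⟨p, rfl⟩, hb⟩ := h
    obtain ⟨q, rfl⟩ := hb.two_dvd
    refine ((intervalIntegrable_and_integral_pairing hT (p + q)).1.const_mul _).congr
      fun t ht => (mulGaussPairing_mul_gaussPairing hT (hsub t ht) p q).symm
  · exact (intervalIntegrable_const (c := (0 : ℝ))).congr
      fun t ht => (mulGaussPairing_mul_gaussPairing_eq_zero hT (hsub t ht) h).symm

lemma integral_mulGaussPairing_mul_gaussPairing {lam : ℝ} (hlam : 0 < lam) (a b : ℕ) :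
    1 / (2 * π) * (1 / (π * lam ^ 2)) *
        ∫ t in (0)..(1 / lam ^ 2), mulGaussPairing (1 / lam ^ 2) a t * gaussPairing (1 / lam ^ 2) b t
      = Htwo lam a b := by
  have hT : 0 < 1 / lam ^ 2 := by positivity
  have hsub : ∀ t ∈ Set.uIcc 0 (1 / lam ^ 2), t ∈ Set.Icc 0 (1 / lam ^ 2) := fun t ht => by
    rwa [Set.uIcc_of_le hT.le] at ht
  by_cases h : Odd a ∧ Even b
  · rw [Htwo, if_pos h]
    obtain ⟨⟨p, rfl⟩, hb⟩ := h
    obtain ⟨q, rfl⟩ := hb.two_dvd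
    rw [intervalIntegral.integral_congr fun t ht =>
        mulGaussPairing_mul_gaussPairing hT (hsub t ht) p q,
      intervalIntegral.integral_const_mul, (intervalIntegrable_and_integral_pairing hT (p + q)).2,
      show (2 * p + 1 + 2 * q + 1) / 2 = p + q + 1 by omega,
      show (2 * p + 1 + 2 * q - 1) / 2 = p + q by omega,
      show (2 * p + 1 - 1) / 2 = p by omega, Nat.choose_symm_add, Nat.add_choose, Nat.factorial_succ (p + q),
      Nat.cast_div (Nat.factorial_mul_factorial_dvd_factorial_add p q) (by positivity),
      show 1 / lam ^ 2 / 2 = 1 / (2 * lam ^ 2) by field_simp]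
    set X := (1 / (2 * lam ^ 2)) ^ (p + q + 1)
    push_cast
    field_simp
  · rw [Htwo, if_neg h, intervalIntegral.integral_congr fun t ht =>
      mulGaussPairing_mul_gaussPairing_eq_zero hT (hsub t ht) h]
    simp

lemma md_eq_of_hasDerivAt (W : ℕ → ℕ → ℝ × ℝ → ℝ)
    (h2 : ∀ j x, HasDerivAt (fun s => W 0 j (x.1, s)) (W 0 (j + 1) x) x.2)
    (h1 : ∀ i j x, HasDerivAt (fun s => W i j (s, x.2)) (W (i + 1) j x) x.1) (m1 m2 : ℕ) :
    md m1 m2 (W 0 0) = W m1 m2 := by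
  have e2 : pd2^[m2] (W 0 0) = W 0 m2 := by
    induction m2 with
    | zero => rfl
    | succ m ih =>
      rw [Function.iterate_succ_apply', ih]
      exact funext fun x => (h2 m x).deriv
  rw [md, e2]
  induction m1 with
  | zero => rfl
  | succ m ih =>
    rw [Function.iterate_succ_apply', ih]
    exact funext fun x => (h1 m m2 x).deriv

lemma md_mul {f g : ℕ → ℝ → ℝ} (c : ℝ) (hf : ∀ n s, HasDerivAt (f n) (f (n + 1) s) s)
    (hg : ∀ n s, HasDerivAt (g n) (g (n + 1) s) s) (m1 m2 : ℕ) :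
    md m1 m2 (fun x => c * (f 0 x.1 * g 0 x.2)) = fun x => c * (f m1 x.1 * g m2 x.2) :=
  md_eq_of_hasDerivAt (fun i j x => c * (f i x.1 * g j x.2))
    (fun j x => ((hg j x.2).const_mul (f 0 x.1)).const_mul c)
    (fun i j x => ((hf i x.1).mul_const (g j x.2)).const_mul c) m1 m2

lemma hasDerivAt_intervalIntegral_param {F F' : ℝ → ℝ → ℝ} (a b : ℝ)
    (hF : Continuous (Function.uncurry F)) (hF' : Continuous (Function.uncurry F'))
    (hd : ∀ t s, HasDerivAt (F t) (F' t s) s) (s₀ : ℝ) :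
    HasDerivAt (fun s => ∫ t in a..b, F t s) (∫ t in a..b, F' t s₀) s₀ := by
  obtain ⟨C, hC⟩ := ((isCompact_uIcc (a := a) (b := b)).prod
    (isCompact_Icc (a := s₀ - 1) (b := s₀ + 1))).exists_bound_of_continuousOn hF'.continuousOn
  have c1 : ∀ s, Continuous fun t => F t s := fun s => by
    simp only [Function.uncurry_def] at hF
    fun_prop
  have c2 : Continuous fun t => F' t s₀ := by
    simp only [Function.uncurry_def] at hF'
    fun_prop
  refine (intervalIntegral.hasDerivAt_integral_of_dominated_loc_of_deriv_le
    (F := fun s t => F t s) (F' := fun s t => F' t s) (bound := fun _ => C)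
    (Icc_mem_nhds (by linarith : s₀ - 1 < s₀) (by linarith : s₀ < s₀ + 1))
    (Filter.Eventually.of_forall fun s => (c1 s).aestronglyMeasurable)
    ((c1 s₀).intervalIntegrable _ _) c2.aestronglyMeasurable
    (Filter.Eventually.of_forall fun t ht s hs => hC (t, s) ⟨Set.uIoc_subset_uIcc ht, hs⟩)
    intervalIntegrable_const
    (Filter.Eventually.of_forall fun t _ s _ => hd t s)).2

lemma md_phi00 (lam : ℝ) (l1 l2 : ℕ) :
    md l1 l2 (phi00 lam) = fun x => 1 / (π * lam ^ 2)
      * (gaussDeriv l1 (1 / lam ^ 2) x.1 * gaussDeriv l2 (1 / lam ^ 2) x.2) := by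
  rw [← md_mul _ (hasDerivAt_gaussDeriv · _) (hasDerivAt_gaussDeriv · _)]
  congr 1
  funext x
  simp only [phi00, gaussDeriv, pow_zero, scaledHermite_zero, one_mul, ← Real.exp_add]
  ring_nf

lemma hpoly_eq (lam : ℝ) (k1 k2 : ℕ) :
    hpoly lam k1 k2 = fun z =>
      scaledHermite (1 / lam ^ 2) k1 z.1 * scaledHermite (1 / lam ^ 2) k2 z.2 := by
  funext z
  set T := 1 / lam ^ 2 with hT
  let g : ℝ → ℕ → ℝ → ℝ :=
    fun a n τ => scaledHermite T n (a - τ) * Real.exp (T * (2 * τ * a - τ ^ 2))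
  have hg : ∀ a n τ, HasDerivAt (g a n) (g a (n + 1) τ) τ := fun a n τ => by
    have h1 : HasDerivAt (fun τ => scaledHermite T n (a - τ))
        (2 * T * n * scaledHermite T (n - 1) (a - τ) * -1) τ :=
      (hasDerivAt_scaledHermite T n (a - τ)).comp τ ((hasDerivAt_id τ).const_sub a)
    have h2 : HasDerivAt (fun τ => Real.exp (T * (2 * τ * a - τ ^ 2)))
        (Real.exp (T * (2 * τ * a - τ ^ 2)) * (2 * T * (a - τ))) τ := by
      refine (((((hasDerivAt_id τ).const_mul 2).mul_const a).sub
        (hasDerivAt_pow 2 τ)).const_mul T).exp.congr_deriv ?_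
      simp
      ring
    refine (h1.mul h2).congr_deriv ?_
    simp only [g, scaledHermite_succ]
    ring
  have h := congrFun (md_mul 1 (hg z.1) (hg z.2) k1 k2) (0, 0)
  have e : (fun x : ℝ × ℝ => 1 * (g z.1 0 x.1 * g z.2 0 x.2)) = fun τ =>
      Real.exp ((2 * (τ.1 * z.1 + τ.2 * z.2) - (τ.1 ^ 2 + τ.2 ^ 2)) / lam ^ 2) := by
    funext τ
    simp only [g, scaledHermite_zero, one_mul, ← Real.exp_add, hT]
    ring_nf
  rw [e] at h
  rw [hpoly, h]
  simp [g]

lemma pd2_hpoly (lam : ℝ) (k1 k2 : ℕ) :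
    pd2 (hpoly lam k1 k2) = fun z => scaledHermite (1 / lam ^ 2) k1 z.1
      * (2 * (1 / lam ^ 2) * k2 * scaledHermite (1 / lam ^ 2) (k2 - 1) z.2) := by
  rw [hpoly_eq]
  exact funext fun z => ((hasDerivAt_scaledHermite (1 / lam ^ 2) k2 z.2).const_mul
    (scaledHermite (1 / lam ^ 2) k1 z.1)).deriv

lemma V002_eq_integral (lam : ℝ) :
    V002 lam = fun x => ∫ t in (0)..(1 / lam ^ 2),
      1 / (2 * π) * (mulGaussDeriv 0 t x.1 * gaussDeriv 0 t x.2) := by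
  funext x
  set r := x.1 ^ 2 + x.2 ^ 2 with hr
  have e : ∀ t, 1 / (2 * π) * (mulGaussDeriv 0 t x.1 * gaussDeriv 0 t x.2)
      = 1 / (2 * π) * x.1 * Real.exp (-r * t) := fun t => by
    have : Real.exp (-r * t) = Real.exp (-t * x.1 ^ 2) * Real.exp (-t * x.2 ^ 2) := by
      rw [← Real.exp_add, hr]
      ring_nf
    simp only [this, mulGaussDeriv, gaussDeriv, scaledHermite_zero, pow_zero, Nat.cast_zero]
    ring
  simp only [e, intervalIntegral.integral_const_mul, V002, ← hr]
  rcases eq_or_ne r 0 with h0 | h0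
  · have : x.1 = 0 := by nlinarith [sq_nonneg x.1, sq_nonneg x.2]
    simp [this]
  · have h1 : ∫ t in (0)..(1 / lam ^ 2), Real.exp (-r * t)
        = (1 - Real.exp (-r / lam ^ 2)) / r := by
      rw [intervalIntegral.integral_eq_sub_of_hasDerivAt (f := fun t => -Real.exp (-r * t) / r)]
      · simp
        ring_nf
      · intro t _
        refine ((((hasDerivAt_id t).const_mul (-r)).exp).neg.div_const r).congr_deriv ?_
        simp
        field_simp
      · exact (by fun_prop : Continuous fun t => Real.exp (-r * t)).intervalIntegrable _ _
    rw [h1]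
    ring

lemma md_V002 (lam : ℝ) (m1 m2 : ℕ) :
    md m1 m2 (V002 lam) = fun x => ∫ t in (0)..(1 / lam ^ 2),
      1 / (2 * π) * (mulGaussDeriv m1 t x.1 * gaussDeriv m2 t x.2) := by
  have cS := fun n => (ModerateGrowth.mulGaussDeriv (T := 0) n).1
  have cE := fun n => (ModerateGrowth.gaussDeriv (T := 0) n).1
  simp only [Function.uncurry_def] at cS cE
  have cS' : ∀ (n : ℕ) (u : ℝ), Continuous fun p : ℝ × ℝ => mulGaussDeriv n p.1 u :=
    fun n u => (cS n).comp (f := fun p : ℝ × ℝ => (p.1, u)) (by fun_prop)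
  have cE' : ∀ (n : ℕ) (u : ℝ), Continuous fun p : ℝ × ℝ => gaussDeriv n p.1 u :=
    fun n u => (cE n).comp (f := fun p : ℝ × ℝ => (p.1, u)) (by fun_prop)
  rw [V002_eq_integral]
  refine md_eq_of_hasDerivAt (fun i j x => ∫ t in (0)..(1 / lam ^ 2),
      1 / (2 * π) * (mulGaussDeriv i t x.1 * gaussDeriv j t x.2)) (fun j x => ?_)
    (fun i j x => ?_) m1 m2
  · exact hasDerivAt_intervalIntegral_param
      (F := fun t s => 1 / (2 * π) * (mulGaussDeriv 0 t x.1 * gaussDeriv j t s))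
      (F' := fun t s => 1 / (2 * π) * (mulGaussDeriv 0 t x.1 * gaussDeriv (j + 1) t s)) _ _
      (continuous_const.mul ((cS' 0 x.1).mul (cE j)))
      (continuous_const.mul ((cS' 0 x.1).mul (cE (j + 1))))
      (fun t s => ((hasDerivAt_gaussDeriv j t s).const_mul _).const_mul _) x.2
  · exact hasDerivAt_intervalIntegral_param
      (F := fun t s => 1 / (2 * π) * (mulGaussDeriv i t s * gaussDeriv j t x.2))
      (F' := fun t s => 1 / (2 * π) * (mulGaussDeriv (i + 1) t s * gaussDeriv j t x.2)) _ _
      (continuous_const.mul ((cS i).mul (cE' j x.2)))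
      (continuous_const.mul ((cS (i + 1)).mul (cE' j x.2)))
      (fun t s => ((hasDerivAt_mulGaussDeriv i t s).mul_const _).const_mul _) x.1

/-- Fubini for products of functions of moderate growth against the Gaussian weight. -/
lemma integral_intervalIntegral_gaussian {T : ℝ} (hT : 0 < T) {F G : ℝ → ℝ → ℝ}
    (hF : ModerateGrowth T F) (hG : ModerateGrowth T G) :
    ∫ x : ℝ × ℝ, ∫ t in (0)..T,
        (F t x.1 * Real.exp (-T * x.1 ^ 2)) * (G t x.2 * Real.exp (-T * x.2 ^ 2))
      = ∫ t in (0)..T, (∫ s, F t s * Real.exp (-T * s ^ 2)) *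
          ∫ s, G t s * Real.exp (-T * s ^ 2) := by
  simp only [intervalIntegral.integral_of_le hT.le]
  rw [integral_integral_swap]
  · refine integral_congr_ae (Filter.Eventually.of_forall fun t => ?_)
    exact integral_prod_mul (fun s => F t s * Real.exp (-T * s ^ 2))
      (fun s => G t s * Real.exp (-T * s ^ 2))
  · obtain ⟨cF, C, N, hC, h⟩ := hF
    obtain ⟨cG, D, M, hD, h'⟩ := hG
    have hb : Integrable (fun z : (ℝ × ℝ) × ℝ =>
        ((C * (1 + z.1.1 ^ 2) ^ N * Real.exp (-T * z.1.1 ^ 2)) *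
        (D * (1 + z.1.2 ^ 2) ^ M * Real.exp (-T * z.1.2 ^ 2))) * (1 : ℝ))
        ((volume : Measure (ℝ × ℝ)).prod (volume.restrict (Set.Ioc 0 T))) :=
      Integrable.mul_prod
        (f := fun x : ℝ × ℝ => (C * (1 + x.1 ^ 2) ^ N * Real.exp (-T * x.1 ^ 2)) *
          (D * (1 + x.2 ^ 2) ^ M * Real.exp (-T * x.2 ^ 2))) (g := fun _ : ℝ => (1 : ℝ))
        ((integrable_one_add_sq_pow_mul_gaussian hT C N).mul_prod
          (integrable_one_add_sq_pow_mul_gaussian hT D M)) (integrable_const 1)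
    refine hb.mono' (Continuous.aestronglyMeasurable ?_) ?_
    · simp only [Function.uncurry_def] at *
      have c1 : Continuous fun z : (ℝ × ℝ) × ℝ => F z.2 z.1.1 :=
        cF.comp (f := fun z : (ℝ × ℝ) × ℝ => (z.2, z.1.1)) (by fun_prop)
      have c2 : Continuous fun z : (ℝ × ℝ) × ℝ => G z.2 z.1.2 :=
        cG.comp (f := fun z : (ℝ × ℝ) × ℝ => (z.2, z.1.2)) (by fun_prop)
      fun_prop
    · have hm : ∀ᵐ z ∂((volume : Measure (ℝ × ℝ)).prod (volume.restrict (Set.Ioc 0 T))),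
          z.2 ∈ Set.Ioc 0 T :=
        Measure.quasiMeasurePreserving_snd.ae (ae_restrict_mem measurableSet_Ioc)
      filter_upwards [hm] with z hz
      have hz' : z.2 ∈ Set.Icc 0 T := ⟨hz.1.le, hz.2⟩
      simp only [Function.uncurry_def, norm_mul, Real.norm_eq_abs, Real.abs_exp, mul_one]
      gcongr
      · exact h _ hz' _
      · exact h' _ hz' _

/-- the combinatorial formula for `Γᴵᴵ`. -/
theorem GammaII_combinatorial_formula (lam : ℝ) (hlam : 0 < lam)
    (k1 k2 l1 l2 m1 m2 : ℕ) :
    (∫ x : ℝ × ℝ, md m1 m2 (V002 lam) x * pd2 (hpoly lam k1 k2) x * md l1 l2 (phi00 lam) x)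
      = ∑ i ∈ Finset.range (min l1 k1 + 1), ∑ j ∈ Finset.range (min l2 (k2 - 1) + 1),
          (Nat.choose l1 i : ℝ) * (Nat.choose l2 j : ℝ) * (-1 : ℝ) ^ (l1 + l2)
            * (2 ^ i * (Nat.descFactorial k1 i : ℝ) / lam ^ (2 * i))
            * (2 ^ (j + 1) * (Nat.descFactorial k2 (j + 1) : ℝ) / lam ^ (2 * (j + 1)))
            * Htwo lam (m1 + (k1 - i) + (l1 - i)) (m2 + (k2 - (j + 1)) + (l2 - j)) := by
  rw [md_V002, pd2_hpoly, md_phi00]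
  have hT : 0 < 1 / lam ^ 2 := by positivity
  have hHtwo := integral_mulGaussPairing_mul_gaussPairing hlam
  have hlamT : ∀ i : ℕ, (2 : ℝ) ^ i / lam ^ (2 * i) = (2 * (1 / lam ^ 2)) ^ i := fun i => by
    rw [mul_one_div, div_pow, pow_mul]
  set T := 1 / lam ^ 2
  set c := 1 / (2 * π) * (1 / (π * lam ^ 2)) with hc
  have hmem : T ∈ Set.Icc 0 T := ⟨hT.le, le_rfl⟩
  have hH := fun n => (ModerateGrowth.scaledHermite (T := T) n).section_right hmem
  have hintegrand : ∀ x : ℝ × ℝ,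
      (∫ t in (0)..T, 1 / (2 * π) * (mulGaussDeriv m1 t x.1 * gaussDeriv m2 t x.2))
        * (scaledHermite T k1 x.1 * (2 * T * k2 * scaledHermite T (k2 - 1) x.2))
        * (1 / (π * lam ^ 2) * (gaussDeriv l1 T x.1 * gaussDeriv l2 T x.2))
      = c * (-1) ^ (l1 + l2) * (2 * T * k2) * ∫ t in (0)..T,
        (mulGaussDeriv m1 t x.1 * scaledHermite T k1 x.1 * scaledHermite T l1 x.1
          * Real.exp (-T * x.1 ^ 2))
        * (gaussDeriv m2 t x.2 * scaledHermite T (k2 - 1) x.2 * scaledHermite T l2 x.2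
          * Real.exp (-T * x.2 ^ 2)) := fun x => by
    rw [mul_assoc, ← intervalIntegral.integral_mul_const, ← intervalIntegral.integral_const_mul]
    refine intervalIntegral.integral_congr fun t _ => ?_
    simp only [gaussDeriv, hc]
    ring
  simp only [hintegrand]
  rw [integral_const_mul, integral_intervalIntegral_gaussian hT
    (F := fun t s => mulGaussDeriv m1 t s * scaledHermite T k1 s * scaledHermite T l1 s)
    (G := fun t s => gaussDeriv m2 t s * scaledHermite T (k2 - 1) s * scaledHermite T l2 s)
    (((ModerateGrowth.mulGaussDeriv m1).mul (hH k1)).mul (hH l1))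
    (((ModerateGrowth.gaussDeriv m2).mul (hH (k2 - 1))).mul (hH l2))]
  have h1 : ∀ t ∈ Set.uIcc 0 T,
      (∫ s, mulGaussDeriv m1 t s * scaledHermite T k1 s * scaledHermite T l1 s
          * Real.exp (-T * s ^ 2))
        * (∫ s, gaussDeriv m2 t s * scaledHermite T (k2 - 1) s * scaledHermite T l2 s
          * Real.exp (-T * s ^ 2))
      = ∑ i ∈ Finset.range (min l1 k1 + 1), ∑ j ∈ Finset.range (min l2 (k2 - 1) + 1),
        ((l1.choose i : ℝ) * (k1.descFactorial i : ℝ) * (2 * T) ^ i)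
          * ((l2.choose j : ℝ) * ((k2 - 1).descFactorial j : ℝ) * (2 * T) ^ j)
          * (mulGaussPairing T (m1 + (k1 - i) + (l1 - i)) t
            * gaussPairing T (m2 + (k2 - 1 - j) + (l2 - j)) t) := fun t ht => by
    rw [Set.uIcc_of_le hT.le] at ht
    rw [integral_mul_hermite_mul_hermite hT (f := fun n => mulGaussDeriv n t)
        (fun n => (ModerateGrowth.mulGaussDeriv n).section_right ht)
        (fun n s => hasDerivAt_mulGaussDeriv n t s),
      integral_mul_hermite_mul_hermite hT (f := fun n => gaussDeriv n t)
        (fun n => (ModerateGrowth.gaussDeriv n).section_right ht)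
        (fun n s => hasDerivAt_gaussDeriv n t s)]
    have h1 := sum_choose_mul_descFactorial_eq l1 k1
      fun i => (2 * T) ^ i * mulGaussPairing T (m1 + (k1 - i) + (l1 - i)) t
    have h2 := sum_choose_mul_descFactorial_eq l2 (k2 - 1)
      fun j => (2 * T) ^ j * gaussPairing T (m2 + (k2 - 1 - j) + (l2 - j)) t
    calc _ = (∑ i ∈ Finset.range (l1 + 1), (l1.choose i : ℝ) * (k1.descFactorial i : ℝ)
            * ((2 * T) ^ i * mulGaussPairing T (m1 + (k1 - i) + (l1 - i)) t))
          * ∑ j ∈ Finset.range (l2 + 1), (l2.choose j : ℝ) * ((k2 - 1).descFactorial j : ℝ)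
            * ((2 * T) ^ j * gaussPairing T (m2 + (k2 - 1 - j) + (l2 - j)) t) := by
          congr 1 <;> refine Finset.sum_congr rfl fun i _ => ?_
          · rw [mulGaussPairing]; ring
          · rw [gaussPairing]; ring
      _ = _ := by
          rw [h1, h2, Finset.sum_mul_sum]
          refine Finset.sum_congr rfl fun i _ => Finset.sum_congr rfl fun j _ => ?_
          ring
  have hI := intervalIntegrable_mulGaussPairing_mul_gaussPairing hT
  have hsum : ∀ i, IntervalIntegrable (fun t => ∑ j ∈ Finset.range (min l2 (k2 - 1) + 1),
      ((l1.choose i : ℝ) * (k1.descFactorial i : ℝ) * (2 * T) ^ i)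
        * ((l2.choose j : ℝ) * ((k2 - 1).descFactorial j : ℝ) * (2 * T) ^ j)
        * (mulGaussPairing T (m1 + (k1 - i) + (l1 - i)) t
          * gaussPairing T (m2 + (k2 - 1 - j) + (l2 - j)) t)) volume 0 T := fun i => by
    rw [← Finset.sum_fn]
    exact IntervalIntegrable.sum _ fun j _ => (hI _ _).const_mul _
  rw [intervalIntegral.integral_congr h1, intervalIntegral.integral_finsetSum fun i _ => hsum i,
    Finset.mul_sum]
  refine Finset.sum_congr rfl fun i _ => ?_
  rw [intervalIntegral.integral_finsetSum fun j _ => (hI _ _).const_mul _, Finset.mul_sum]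
  refine Finset.sum_congr rfl fun j _ => ?_
  have hk : (k2 : ℝ) * ((k2 - 1).descFactorial j : ℝ) = (k2.descFactorial (j + 1) : ℝ) := by
    cases k2 with
    | zero => simp
    | succ k =>
      rw [Nat.succ_descFactorial_succ]
      push_cast
      simp
  rw [intervalIntegral.integral_const_mul, Nat.add_comm j 1, ← Nat.sub_sub, ← hHtwo,
    Nat.add_comm 1 j, mul_div_right_comm, mul_div_right_comm, hlamT, hlamT, ← hk]
  ring
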